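/- arXiv:2503.07625 — 6 statements merged into one kernel-verified Lean document; each statement's English description precedes it below -/
import Mathlib

section
/- There exists a function c : ℝ → ℝ with c(x) = o(1) as x → ∞ such that for all sufficiently large real x, π(x) = (1 + c(x)) · ∫_2^x 1/log t dt. -/
open Filter Real MeasureTheory

open Complex Set in
theorem laplace_mul_fourier_eq {f : ℝ → ℂ} {C : ℝ} (hfm : Measurable f) (hf : ∀ u, ‖f u‖ ≤ C)
    {H : ℂ → ℂ} (hL : ∀ s : ℂ, 0 < s.re → ∫ u in Ioi (0 : ℝ), f u * cexp (-s * u) = H s)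
    {k : ℝ → ℂ} (hk : Integrable k) {ε : ℝ} (hε : 0 < ε) (x : ℝ) :
    ∫ u in Ioi (0 : ℝ), f u * cexp (-ε * u) * (∫ y : ℝ, k y * cexp (-I * y * (u - x))) =
      ∫ y : ℝ, k y * cexp (I * y * x) * H (ε + I * y) := by
  have hint : Integrable (Function.uncurry fun (y u : ℝ) ↦
      k y * cexp (I * y * x) * (f u * cexp (-(ε + I * y) * u)))
      (volume.prod (volume.restrict (Ioi 0))) := by
    have hexp : Integrable (fun u : ℝ ↦ (C * rexp (-ε * u) : ℝ)) (volume.restrict (Ioi 0)) :=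
      (exp_neg_integrableOn_Ioi 0 hε).const_mul C
    refine (hk.norm.mul_prod hexp).mono' ?_ (.of_forall fun ⟨y, u⟩ ↦ ?_)
    · have h1 := hk.aestronglyMeasurable.comp_fst (ν := volume.restrict (Ioi (0 : ℝ)))
      refine (h1.mul ?_).mul (AEStronglyMeasurable.mul ?_ ?_)
      · exact Continuous.aestronglyMeasurable (by fun_prop)
      · exact (hfm.comp measurable_snd).aestronglyMeasurable
      · exact Continuous.aestronglyMeasurable (by fun_prop)
    · simp only [Function.uncurry_apply_pair, norm_mul, Complex.norm_exp]
      simp only [mul_re, I_re, I_im, ofReal_re, ofReal_im, mul_im, neg_re, neg_im, add_re, add_im]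
      simp only [zero_mul, mul_zero, sub_zero, one_mul, zero_add, add_zero, sub_self, Real.exp_zero,
        mul_one]
      gcongr
      exact hf u
  calc
    _ = ∫ u in Ioi (0 : ℝ), ∫ y : ℝ, k y * cexp (I * y * x) *
          (f u * cexp (-(ε + I * y) * u)) := by
      congr 1 with u
      rw [← integral_const_mul]
      congr 1 with y
      have : cexp (-I * y * (u - x)) = cexp (I * y * x) * cexp (-I * y * u) := by
        rw [← Complex.exp_add]; ring_nf
      have h2 : cexp (-(ε + I * y) * u) = cexp (-ε * u) * cexp (-I * y * u) := by
        rw [← Complex.exp_add]; ring_nf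
      rw [this, h2]; ring
    _ = _ := by
      rw [← integral_integral_swap hint]
      congr 1 with y
      rw [integral_const_mul, hL _ (by simpa using hε)]

open Complex Set Topology in
/-- If the Laplace transform of the bounded function `f` extends continuously to `0 ≤ re s`, then the
integral of `f` against a translated Fourier transform of `k` can be computed on the line
`re s = 0`. -/
theorem integral_mul_fourier_eq {f : ℝ → ℂ} {C : ℝ} (hfm : Measurable f) (hf : ∀ u, ‖f u‖ ≤ C)
    {H : ℂ → ℂ} (hH : ContinuousOn H {s | 0 ≤ s.re})
    (hL : ∀ s : ℂ, 0 < s.re → ∫ u in Ioi (0 : ℝ), f u * cexp (-s * u) = H s)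
    {k : ℝ → ℂ} (hk : Continuous k) (hkc : HasCompactSupport k)
    (hK : Integrable fun v : ℝ ↦ ∫ y : ℝ, k y * cexp (-I * y * v)) (x : ℝ) :
    ∫ u in Ioi (0 : ℝ), f u * (∫ y : ℝ, k y * cexp (-I * y * (u - x))) =
      ∫ y : ℝ, k y * cexp (I * y * x) * H (I * y) := by
  have hki : Integrable k := hk.integrable_of_hasCompactSupport hkc
  have hKx : Integrable fun u : ℝ ↦ ∫ y : ℝ, k y * cexp (-I * y * (u - x)) := by
    simpa using hK.comp_sub_right x
  have hpos : ∀ᶠ ε : ℝ in 𝓝[>] 0, 0 < ε := self_mem_nhdsWithin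
  have h1 : Tendsto (fun ε : ℝ ↦ ∫ u in Ioi (0 : ℝ), f u * cexp (-ε * u) *
      (∫ y : ℝ, k y * cexp (-I * y * (u - x)))) (𝓝[>] 0)
      (𝓝 (∫ u in Ioi (0 : ℝ), f u * (∫ y : ℝ, k y * cexp (-I * y * (u - x))))) := by
    refine tendsto_integral_filter_of_dominated_convergence
      (fun u ↦ C * ‖∫ y : ℝ, k y * cexp (-I * y * (u - x))‖) ?_ ?_ ?_ ?_
    · refine .of_forall fun ε ↦ (AEStronglyMeasurable.mul hfm.aestronglyMeasurable ?_).mul ?_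
      · exact Continuous.aestronglyMeasurable (by fun_prop)
      · exact hKx.aestronglyMeasurable.restrict
    · filter_upwards [hpos] with ε hε
      filter_upwards [ae_restrict_mem measurableSet_Ioi] with u hu
      rw [norm_mul, norm_mul]
      gcongr
      rw [← mul_one C]
      gcongr
      · exact (norm_nonneg _).trans (hf 0)
      · exact hf u
      · rw [Complex.norm_exp, Real.exp_le_one_iff]
        simp only [neg_mul, neg_re, mul_re, ofReal_re, ofReal_im]
        have : 0 < ε * u := mul_pos hε hu
        linarith
    · exact (hKx.norm.const_mul C).restrict
    · refine .of_forall fun u ↦ ?_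
      have : Continuous fun ε : ℝ ↦ f u * cexp (-ε * u) *
        (∫ y : ℝ, k y * cexp (-I * y * (u - x))) := by fun_prop
      simpa using (this.tendsto 0).mono_left nhdsWithin_le_nhds
  have h2 : Tendsto (fun ε : ℝ ↦ ∫ y : ℝ, k y * cexp (I * y * x) * H (ε + I * y)) (𝓝[>] 0)
      (𝓝 (∫ y : ℝ, k y * cexp (I * y * x) * H (I * y))) := by
    obtain ⟨M, hM⟩ : ∃ M, ∀ z ∈ (fun p : ℝ × ℝ ↦ (p.1 + I * p.2 : ℂ)) '' (Icc 0 1 ×ˢ tsupport k),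
        ‖H z‖ ≤ M := by
      refine ((isCompact_Icc.prod hkc).image (by fun_prop)).exists_bound_of_continuousOn
        (hH.mono ?_)
      rintro _ ⟨⟨a, b⟩, ⟨ha, -⟩, rfl⟩
      simpa using ha.1
    have hc (ε : ℝ) (hε : 0 ≤ ε) : Continuous fun y : ℝ ↦ H (ε + I * y) :=
      hH.comp_continuous (by fun_prop) (fun y ↦ by simpa using hε)
    refine tendsto_integral_filter_of_dominated_convergence (fun y ↦ ‖k y‖ * M) ?_ ?_ ?_ ?_
    · filter_upwards [hpos] with ε hε
      have h : Continuous fun y : ℝ ↦ k y * cexp (I * y * x) := by fun_prop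
      exact (h.mul (hc ε hε.le)).aestronglyMeasurable
    · have h1 : ∀ᶠ ε : ℝ in 𝓝[>] 0, ε < 1 :=
        nhdsWithin_le_nhds (eventually_lt_nhds one_pos)
      filter_upwards [hpos, h1] with ε hε hε1
      refine .of_forall fun y ↦ ?_
      have he : ‖cexp (I * y * x)‖ = 1 := by
        rw [show I * y * x = ((y * x : ℝ) : ℂ) * I by push_cast; ring, norm_exp_ofReal_mul_I]
      rw [norm_mul, norm_mul, he, mul_one]
      by_cases hy : k y = 0
      · simp [hy]
      · gcongr
        exact hM _ ⟨(ε, y), ⟨⟨hε.le, hε1.le⟩, subset_tsupport _ hy⟩, rfl⟩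
    · exact hki.norm.mul_const M
    · refine .of_forall fun y ↦ tendsto_const_nhds.mul ?_
      have h3 : ContinuousWithinAt H {s | 0 ≤ s.re} (I * y) := hH _ (by simp)
      refine h3.tendsto.comp (tendsto_nhdsWithin_iff.2 ⟨?_, ?_⟩)
      · have : Continuous fun ε : ℝ ↦ (ε + I * y : ℂ) := by fun_prop
        simpa using (this.tendsto 0).mono_left nhdsWithin_le_nhds
      · filter_upwards [hpos] with ε hε
        simpa using hε.le
  refine tendsto_nhds_unique (h1.congr' ?_) h2
  filter_upwards [hpos] with ε hε
  exact laplace_mul_fourier_eq hfm hf hL hki hε x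

open Complex Set Topology FourierTransform in
/-- A bounded function whose Laplace transform extends continuously to `0 ≤ re s` tends to zero at
infinity in mean against the Fourier transform of any compactly supported function. -/
theorem tendsto_integral_mul_fourier {f : ℝ → ℂ} {C : ℝ} (hfm : Measurable f)
    (hf : ∀ u, ‖f u‖ ≤ C)
    {H : ℂ → ℂ} (hH : ContinuousOn H {s | 0 ≤ s.re})
    (hL : ∀ s : ℂ, 0 < s.re → ∫ u in Ioi (0 : ℝ), f u * cexp (-s * u) = H s)
    {k : ℝ → ℂ} (hk : Continuous k) (hkc : HasCompactSupport k)
    (hK : Integrable fun v : ℝ ↦ ∫ y : ℝ, k y * cexp (-I * y * v)) :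
    Tendsto (fun x : ℝ ↦ ∫ u in Ioi (0 : ℝ), f u * (∫ y : ℝ, k y * cexp (-I * y * (u - x))))
      atTop (𝓝 0) := by
  have h1 := (Real.zero_at_infty_fourier fun y : ℝ ↦ k y * H (I * y)).comp
    ((tendsto_neg_atTop_atBot.comp
      (tendsto_id.atTop_div_const (r := 2 * π) (by positivity))).mono_right atBot_le_cocompact)
  refine h1.congr fun x ↦ ?_
  rw [integral_mul_fourier_eq hfm hf hH hL hk hkc hK x]
  simp only [Function.comp_apply, id, Real.fourier_real_eq_integral_exp_smul]
  congr 1 with y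
  rw [smul_eq_mul, show ((-2 * π * y * -(x / (2 * π)) : ℝ) : ℂ) * I = I * y * x by
    push_cast; field_simp]
  ring

open Complex in
/-- The Fourier transform of the tent function is the Fejér kernel. -/
theorem integral_tent_mul_cexp (v : ℝ) :
    ∫ y : ℝ, ((max 0 (1 - |y|) : ℝ) : ℂ) * cexp (-I * y * v) = ((sinc (v / 2) ^ 2 : ℝ) : ℂ) := by
  have hsupp : Function.support (fun y : ℝ ↦ ((max 0 (1 - |y|) : ℝ) : ℂ) * cexp (-I * y * v)) ⊆
      Set.Ioc (-1) 1 := by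
    intro y hy
    by_contra h
    refine hy ?_
    have : 1 - |y| ≤ 0 := by
      simp only [Set.mem_Ioc, not_and_or, not_lt, not_le] at h
      rcases h with h | h <;> grind
    simp [max_eq_left this]
  rw [← intervalIntegral.integral_eq_integral_of_support_subset hsupp]
  have hcont : Continuous fun y : ℝ ↦ ((max 0 (1 - |y|) : ℝ) : ℂ) * cexp (-I * y * v) := by
    fun_prop
  rw [← intervalIntegral.integral_add_adjacent_intervals (b := 0)
    (hcont.intervalIntegrable _ _) (hcont.intervalIntegrable _ _)]
  have e1 : ∫ y in (-1 : ℝ)..0, ((max 0 (1 - |y|) : ℝ) : ℂ) * cexp (-I * y * v) =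
      ∫ y in (-1 : ℝ)..0, (1 + y : ℂ) * cexp (-I * v * y) := by
    refine intervalIntegral.integral_congr fun y hy ↦ ?_
    rw [Set.uIcc_of_le (by norm_num)] at hy
    rw [abs_of_nonpos hy.2, max_eq_right (by linarith [hy.1])]
    push_cast; ring_nf
  have e2 : ∫ y in (0 : ℝ)..1, ((max 0 (1 - |y|) : ℝ) : ℂ) * cexp (-I * y * v) =
      ∫ y in (0 : ℝ)..1, (1 - y : ℂ) * cexp (-I * v * y) := by
    refine intervalIntegral.integral_congr fun y hy ↦ ?_
    rw [Set.uIcc_of_le (by norm_num)] at hy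
    rw [abs_of_nonneg hy.1, max_eq_right (by linarith [hy.2])]
    push_cast; ring_nf
  rw [e1, e2]
  rcases eq_or_ne v 0 with rfl | hv
  · have h1 : ∫ y in (-1 : ℝ)..0, (1 + y : ℂ) = 1 / 2 := by
      have : ∫ y in (-1 : ℝ)..0, (1 + y : ℂ) = ((∫ y in (-1 : ℝ)..0, (1 + y)) : ℝ) := by
        rw [← intervalIntegral.integral_ofReal]; push_cast; rfl
      rw [this, intervalIntegral.integral_add (by simp) (by simp)]; norm_num
    have h2 : ∫ y in (0 : ℝ)..1, (1 - y : ℂ) = 1 / 2 := by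
      have : ∫ y in (0 : ℝ)..1, (1 - y : ℂ) = ((∫ y in (0 : ℝ)..1, (1 - y)) : ℝ) := by
        rw [← intervalIntegral.integral_ofReal]; push_cast; rfl
      rw [this, intervalIntegral.integral_sub (by simp) (by simp)]; norm_num
    simp [h1, h2]; norm_num
  · have hv' : (v : ℂ) ≠ 0 := by exact_mod_cast hv
    have hc : -I * v ≠ 0 := by simp [hv]
    set c : ℂ := -I * v with hcdef
    have hexp (y : ℝ) : HasDerivAt (fun y : ℝ ↦ cexp (c * y)) (c * cexp (c * y)) y := by
      have := ((hasDerivAt_id (y : ℂ)).const_mul c).cexp.comp_ofReal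
      simpa [mul_comm] using this
    have hid (y : ℝ) : HasDerivAt (fun y : ℝ ↦ (y : ℂ)) 1 y := (hasDerivAt_id (y : ℂ)).comp_ofReal
    have i1 : ∫ y in (-1 : ℝ)..0, (1 + y : ℂ) * cexp (c * y) =
        1 / c - 1 / c ^ 2 + cexp (-c) / c ^ 2 := by
      rw [intervalIntegral.integral_eq_sub_of_hasDerivAt
        (f := fun y : ℝ ↦ (1 + y : ℂ) * cexp (c * y) / c - cexp (c * y) / c ^ 2)]
      · simp
      · intro y _
        refine (((((hid y).const_add 1).mul (hexp y)).div_const c).sub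
          ((hexp y).div_const (c ^ 2))).congr_deriv ?_
        field_simp; ring
      · exact Continuous.intervalIntegrable (by fun_prop) _ _
    have i2 : ∫ y in (0 : ℝ)..1, (1 - y : ℂ) * cexp (c * y) =
        cexp c / c ^ 2 - 1 / c - 1 / c ^ 2 := by
      rw [intervalIntegral.integral_eq_sub_of_hasDerivAt
        (f := fun y : ℝ ↦ (1 - y : ℂ) * cexp (c * y) / c + cexp (c * y) / c ^ 2)]
      · simp; ring
      · intro y _
        refine (((((hid y).const_sub 1).mul (hexp y)).div_const c).add
          ((hexp y).div_const (c ^ 2))).congr_deriv ?_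
        field_simp; ring
      · exact Continuous.intervalIntegrable (by fun_prop) _ _
    rw [i1, i2, sinc_of_ne_zero (by simpa using hv)]
    have hcos : cexp c + cexp (-c) = 2 * Complex.cos v := by
      rw [Complex.cos, hcdef]; ring_nf
    have hsin : Complex.cos v = 1 - 2 * Complex.sin (v / 2) ^ 2 := by
      have h := Complex.cos_two_mul (v / 2 : ℂ)
      rw [mul_div_cancel₀ _ (two_ne_zero), Complex.cos_sq'] at h
      rw [h]; ring
    have hc2 : c ^ 2 = - v ^ 2 := by rw [hcdef, mul_pow, neg_sq, I_sq]; ring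
    push_cast
    rw [div_pow, div_pow]
    calc _ = (cexp c + cexp (-c) - 2) / c ^ 2 := by ring
      _ = _ := by
        rw [hcos, hsin, hc2]; field_simp; ring

theorem integrable_sinc_half_sq : Integrable fun v : ℝ ↦ sinc (v / 2) ^ 2 := by
  refine (integrable_inv_one_add_sq.const_mul 5).mono'
    (Continuous.aestronglyMeasurable (by fun_prop)) (.of_forall fun v ↦ ?_)
  rw [Real.norm_of_nonneg (by positivity), ← div_eq_mul_inv, le_div_iff₀ (by positivity)]
  have h1 : sinc (v / 2) ^ 2 ≤ 1 := (sq_le_one_iff_abs_le_one _).2 (abs_sinc_le_one _)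
  have h2 : sinc (v / 2) ^ 2 * v ^ 2 ≤ 4 := by
    rcases eq_or_ne v 0 with rfl | hv
    · simp
    · rw [sinc_of_ne_zero (by simpa using hv)]
      have := sin_sq_le_one (v / 2)
      field_simp
      linarith
  linarith

theorem integral_sinc_half_sq_pos : 0 < ∫ v : ℝ, sinc (v / 2) ^ 2 := by
  refine integral_pos_of_integrable_nonneg_nonzero (x := 0) (by fun_prop) integrable_sinc_half_sq
    (fun v ↦ by positivity) (by simp)

open Complex in
theorem integral_scaled_tent_mul_cexp {l : ℝ} (hl : 0 < l) (v : ℝ) :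
    ∫ y : ℝ, ((max 0 (1 - |y / l|) : ℝ) : ℂ) * cexp (-I * y * v) =
      ((l * sinc (l * v / 2) ^ 2 : ℝ) : ℂ) := by
  have := Measure.integral_comp_div
    (fun y : ℝ ↦ ((max 0 (1 - |y|) : ℝ) : ℂ) * cexp (-I * y * (l * v : ℝ))) l
  rw [integral_tent_mul_cexp, abs_of_pos hl] at this
  rw [ofReal_mul, ← real_smul, ← this]
  congr 1 with y
  have : (l : ℂ) ≠ 0 := by exact_mod_cast hl.ne'
  rw [show (-I * (y / l : ℝ) * (l * v : ℝ) : ℂ) = -I * y * v by push_cast; field_simp]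

open Topology Set in
theorem tendsto_integral_Icc_atTop {g : ℝ → ℝ} (hg : Integrable g) :
    Tendsto (fun R : ℝ ↦ ∫ v in Icc (-R) R, g v) atTop (𝓝 (∫ v, g v)) := by
  have := intervalIntegral_tendsto_integral hg tendsto_neg_atTop_atBot tendsto_id
  refine this.congr' ?_
  filter_upwards [eventually_ge_atTop 0] with R hR
  rw [intervalIntegral.integral_of_le (by simp; linarith), integral_Icc_eq_integral_Ioc]; rfl

open Topology Set in
/-- A Tauberian theorem: a bounded nonnegative function that decreases at most exponentially and whose
weighted averages against all dilates of a nonnegative kernel tend to one tends to one itself. -/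
theorem tendsto_one_of_tendsto_integral_dilate {B κ : ℝ → ℝ} {C : ℝ} (hBm : Measurable B)
    (hB0 : ∀ u, 0 ≤ B u) (hBC : ∀ u, B u ≤ C) (hB : ∀ u h, 0 ≤ h → B u ≤ rexp h * B (u + h))
    (hκ : Integrable κ) (hκ0 : ∀ v, 0 ≤ κ v) (hκpos : 0 < ∫ v, κ v)
    (hlim : ∀ l : ℝ, 0 < l →
      Tendsto (fun x : ℝ ↦ ∫ v, B (x + v / l) * κ v) atTop (𝓝 (∫ v, κ v))) :
    Tendsto B atTop (𝓝 1) := by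
  set J : ℝ := ∫ v, κ v with hJ
  set j : ℝ → ℝ := fun d ↦ ∫ v in Icc (-(1 / d)) (1 / d), κ v with hj
  have hjlim : Tendsto j (𝓝[>] 0) (𝓝 J) := by
    have := (tendsto_integral_Icc_atTop hκ).comp tendsto_inv_nhdsGT_zero
    simpa [hj, Function.comp_def] using this
  have hexp (c : ℝ) : Tendsto (fun d : ℝ ↦ rexp (c * d)) (𝓝[>] 0) (𝓝 1) := by
    have : Continuous fun d : ℝ ↦ rexp (c * d) := by fun_prop
    simpa using (this.tendsto 0).mono_left nhdsWithin_le_nhds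
  have hint (l x : ℝ) : Integrable fun v ↦ B (x + v / l) * κ v := by
    refine hκ.bdd_mul (c := C) (hBm.comp (by fun_prop)).aestronglyMeasurable (.of_forall fun v ↦ ?_)
    rw [Real.norm_of_nonneg (hB0 _)]
    exact hBC _
  have hpos : ∀ᶠ d : ℝ in 𝓝[>] 0, 0 < d := self_mem_nhdsWithin
  have hjpos : ∀ᶠ d : ℝ in 𝓝[>] 0, 0 < j d := hjlim.eventually (lt_mem_nhds hκpos)
  have hw {d v : ℝ} (hd : 0 < d) (hv : v ∈ Icc (-(1 / d)) (1 / d)) :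
      |v / (1 / d ^ 2)| ≤ d := by
    have h1 : |v| ≤ 1 / d := abs_le.2 hv
    rw [abs_div, abs_of_pos (show 0 < 1 / d ^ 2 by positivity), div_le_iff₀ (by positivity)]
    calc |v| ≤ 1 / d := h1
      _ = _ := by field_simp
  refine tendsto_order.2 ⟨fun a ha ↦ ?_, fun a ha ↦ ?_⟩
  · have h : Tendsto (fun d ↦ rexp (-2 * d) * ((J - C * (J - j d)) / j d)) (𝓝[>] 0) (𝓝 1) := by
      have := (hexp (-2)).mul (((tendsto_const_nhds (x := J)).sub
        (((tendsto_const_nhds (x := J)).sub hjlim).const_mul C)).div hjlim hκpos.ne')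
      simpa [hκpos.ne'] using this
    obtain ⟨d, hd, hjd, hda⟩ := (hpos.and (hjpos.and (h.eventually (lt_mem_nhds ha)))).exists
    have hx : Tendsto (fun x : ℝ ↦ rexp (-2 * d) *
        (((∫ v, B (x + v / (1 / d ^ 2)) * κ v) - C * (J - j d)) / j d)) atTop
        (𝓝 (rexp (-2 * d) * ((J - C * (J - j d)) / j d))) :=
      (((hlim _ (by positivity)).sub_const _).div_const _).const_mul _
    have hx' := (tendsto_atTop_add_const_right atTop (-d) tendsto_id).eventually
      (hx.eventually (lt_mem_nhds hda))
    filter_upwards [hx'] with x hx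
    refine hx.trans_le ?_
    simp only [id]
    set y := x + -d with hy
    have key : ∫ v, B (y + v / (1 / d ^ 2)) * κ v ≤ rexp (2 * d) * B x * j d + C * (J - j d) := by
      rw [← integral_add_compl (s := Icc (-(1 / d)) (1 / d)) measurableSet_Icc (hint _ _)]
      have hJj : J - j d = ∫ v in (Icc (-(1 / d)) (1 / d))ᶜ, κ v := by
        rw [sub_eq_iff_eq_add', hJ, hj, integral_add_compl measurableSet_Icc hκ]
      rw [hJj, hj, ← integral_const_mul, ← integral_const_mul]
      refine add_le_add ?_ ?_
      · refine setIntegral_mono_on (hint _ _).integrableOn (hκ.const_mul _).integrableOn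
          measurableSet_Icc fun v hv ↦ ?_
        refine mul_le_mul_of_nonneg_right ?_ (hκ0 v)
        have h2 := abs_le.1 (hw hd hv)
        have h3 := hB (y + v / (1 / d ^ 2)) (d - v / (1 / d ^ 2)) (by linarith)
        rw [show y + v / (1 / d ^ 2) + (d - v / (1 / d ^ 2)) = x by rw [hy]; ring] at h3
        refine h3.trans (mul_le_mul_of_nonneg_right (exp_le_exp.2 (by linarith)) (hB0 x))
      · refine setIntegral_mono (hint _ _).integrableOn (hκ.const_mul _).integrableOn fun v ↦ ?_
        exact mul_le_mul_of_nonneg_right (hBC _) (hκ0 v)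
    rw [neg_mul, Real.exp_neg, inv_mul_le_iff₀ (exp_pos _), div_le_iff₀ hjd]
    linarith
  · have h : Tendsto (fun d ↦ rexp (2 * d) * (J / j d)) (𝓝[>] 0) (𝓝 1) := by
      have := (hexp 2).mul ((tendsto_const_nhds (x := J)).div hjlim hκpos.ne')
      simpa [hκpos.ne'] using this
    obtain ⟨d, hd, hjd, hda⟩ := (hpos.and (hjpos.and (h.eventually (gt_mem_nhds ha)))).exists
    have hx : Tendsto (fun x : ℝ ↦ rexp (2 * d) *
        ((∫ v, B (x + v / (1 / d ^ 2)) * κ v) / j d)) atTop (𝓝 (rexp (2 * d) * (J / j d))) :=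
      ((hlim _ (by positivity)).div_const _).const_mul _
    have hx' := (tendsto_atTop_add_const_right atTop d tendsto_id).eventually
      (hx.eventually (gt_mem_nhds hda))
    filter_upwards [hx'] with x hx
    refine lt_of_le_of_lt ?_ hx
    simp only [id]
    set y := x + d with hy
    have key : rexp (-(2 * d)) * B x * j d ≤ ∫ v, B (y + v / (1 / d ^ 2)) * κ v := by
      refine le_trans ?_ (setIntegral_le_integral (s := Icc (-(1 / d)) (1 / d)) (hint _ _)
        (.of_forall fun v ↦ mul_nonneg (hB0 _) (hκ0 v)))
      rw [hj, ← integral_const_mul]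
      refine setIntegral_mono_on (hκ.const_mul _).integrableOn (hint _ _).integrableOn
        measurableSet_Icc fun v hv ↦ ?_
      refine mul_le_mul_of_nonneg_right ?_ (hκ0 v)
      have h2 := abs_le.1 (hw hd hv)
      have h3 := hB x (d + v / (1 / d ^ 2)) (by linarith)
      rw [show x + (d + v / (1 / d ^ 2)) = y + v / (1 / d ^ 2) by rw [hy]; ring] at h3
      rw [Real.exp_neg, inv_mul_le_iff₀ (exp_pos _)]
      refine h3.trans (mul_le_mul_of_nonneg_right (exp_le_exp.2 (by linarith)) (hB0 _))
    rw [Real.exp_neg, mul_assoc, inv_mul_le_iff₀ (exp_pos _)] at key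
    rwa [mul_div_assoc', le_div_iff₀ hjd]

open Complex ArithmeticFunction in
theorem exists_continuousOn_eq_LSeries_vonMangoldt_sub :
    ∃ G : ℂ → ℂ, ContinuousOn G {s | 1 ≤ s.re} ∧
      ∀ s : ℂ, 1 < s.re → LSeries (fun n ↦ (vonMangoldt n : ℂ)) s - 1 / (s - 1) = G s := by
  refine ⟨_, vonMangoldt.continuousOn_LFunctionResidueClassAux (0 : ZMod 1), fun s hs ↦ ?_⟩
  rw [vonMangoldt.eqOn_LFunctionResidueClassAux (q := 1) (a := 0) (isUnit_of_subsingleton _) hs]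
  have : vonMangoldt.residueClass (0 : ZMod 1) = fun n ↦ vonMangoldt n := by
    ext n
    simp [vonMangoldt.residueClass, Subsingleton.elim (n : ZMod 1) 0]
  simp [this]

open Complex ArithmeticFunction Chebyshev in
/-- The Dirichlet series of `Λ` as the Laplace transform of `ψ (exp u)`. -/
theorem LSeries_vonMangoldt_eq_laplace {s : ℂ} (hs : 1 < s.re) :
    LSeries (fun n ↦ (vonMangoldt n : ℂ)) s =
      s * ∫ u in Set.Ioi (0 : ℝ), (psi (rexp u) : ℂ) * cexp (-s * u) := by
  have hsum (t : ℝ) : ∑ k ∈ Finset.Icc 1 ⌊t⌋₊, vonMangoldt k = psi t := rfl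
  rw [LSeries_eq_mul_integral_of_nonneg (fun n ↦ vonMangoldt n) zero_le_one hs ?_
    fun n ↦ vonMangoldt_nonneg]
  · have himg : rexp '' Set.Ioi 0 = Set.Ioi 1 := by
      ext t
      refine ⟨?_, fun ht ↦ ⟨Real.log t, Real.log_pos ht, Real.exp_log (one_pos.trans ht)⟩⟩
      rintro ⟨u, hu, rfl⟩
      exact Real.one_lt_exp_iff.2 hu
    rw [← himg, integral_image_eq_integral_abs_deriv_smul measurableSet_Ioi
      (fun u _ ↦ (Real.hasDerivAt_exp u).hasDerivWithinAt) Real.exp_injective.injOn]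
    congr 2 with u
    rw [abs_of_pos (Real.exp_pos u), real_smul, ← hsum]
    push_cast
    rw [← Complex.ofReal_exp, cpow_def_of_ne_zero (by exact_mod_cast (Real.exp_pos u).ne'),
      ← ofReal_log (Real.exp_pos u).le, Real.log_exp, mul_left_comm, ofReal_exp, ← Complex.exp_add]
    ring_nf
  · refine Asymptotics.IsBigO.of_bound (Real.log 4 + 4) (.of_forall fun n ↦ ?_)
    have := psi_le_const_mul_self (Nat.cast_nonneg' n : (0 : ℝ) ≤ n)
    rw [← hsum, Nat.floor_natCast] at this
    rw [Real.norm_of_nonneg (Finset.sum_nonneg fun _ _ ↦ vonMangoldt_nonneg), Real.rpow_one,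
      Real.norm_natCast]
    exact this

open Chebyshev in
theorem psi_exp_mul_exp_neg_nonneg (u : ℝ) : 0 ≤ psi (rexp u) * rexp (-u) :=
  mul_nonneg (psi_nonneg _) (exp_pos _).le

open Chebyshev in
theorem psi_exp_mul_exp_neg_le (u : ℝ) : psi (rexp u) * rexp (-u) ≤ log 4 + 4 := by
  rw [Real.exp_neg, ← div_eq_mul_inv, div_le_iff₀ (exp_pos u)]
  exact psi_le_const_mul_self (exp_pos u).le

open Complex ArithmeticFunction Chebyshev in
theorem exists_continuousOn_eq_laplace_psi :
    ∃ H : ℂ → ℂ, ContinuousOn H {s | 0 ≤ s.re} ∧ ∀ s : ℂ, 0 < s.re →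
      ∫ u in Set.Ioi (0 : ℝ), ((psi (rexp u) * rexp (-u) : ℝ) - 1 : ℂ) * cexp (-s * u) = H s := by
  obtain ⟨G, hG, hGL⟩ := exists_continuousOn_eq_LSeries_vonMangoldt_sub
  refine ⟨fun s ↦ (G (1 + s) - 1) / (1 + s), ?_, fun s hs ↦ ?_⟩
  · refine ContinuousOn.div ((hG.comp (by fun_prop) fun s hs ↦ ?_).sub continuousOn_const)
      (by fun_prop) fun s hs h ↦ ?_
    · simpa using hs
    · have := congrArg re h
      simp only [Set.mem_ofPred_eq, add_re, one_re, zero_re] at hs this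
      linarith
  · have h1 : ∫ u in Set.Ioi (0 : ℝ), cexp (-s * u) = 1 / s := by
      rw [integral_exp_mul_complex_Ioi (by simpa using hs)]
      simp
    have h2 : (1 + s) * ∫ u in Set.Ioi (0 : ℝ), ((psi (rexp u) * rexp (-u) : ℝ) : ℂ) * cexp (-s * u)
        = G (1 + s) + 1 / s := by
      have := LSeries_vonMangoldt_eq_laplace (s := 1 + s) (by simpa using hs)
      rw [← hGL (1 + s) (by simpa using hs), this]
      simp only [add_sub_cancel_left, sub_add_cancel]
      congr 2 with u
      rw [ofReal_mul, mul_assoc, ofReal_exp, ← Complex.exp_add]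
      push_cast
      ring_nf
    have hs0 : s ≠ 0 := by rintro rfl; simp at hs
    have hs1 : 1 + s ≠ 0 := by
      intro h
      have := congrArg re h
      simp only [add_re, one_re, zero_re] at this
      linarith
    have i1 : IntegrableOn (fun u : ℝ ↦ cexp (-s * u)) (Set.Ioi 0) :=
      integrableOn_exp_mul_complex_Ioi (by simpa using hs) 0
    have i2 : IntegrableOn (fun u : ℝ ↦ ((psi (rexp u) * rexp (-u) : ℝ) : ℂ) * cexp (-s * u))
        (Set.Ioi 0) := by
      refine i1.bdd_mul (c := Real.log 4 + 4) ?_ (.of_forall fun u ↦ ?_)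
      · have := psi_mono.measurable
        exact Measurable.aestronglyMeasurable (by fun_prop)
      · rw [norm_real, Real.norm_of_nonneg (psi_exp_mul_exp_neg_nonneg u)]
        exact psi_exp_mul_exp_neg_le u
    simp only [sub_mul, one_mul]
    rw [integral_sub i2 i1, h1]
    rw [mul_comm, ← eq_div_iff hs1] at h2
    rw [h2]
    field_simp
    ring

theorem integral_comp_mul_sub {l : ℝ} (hl : 0 < l) (x : ℝ) (g : ℝ → ℝ) :
    ∫ u, l * g (l * (u - x)) = ∫ v, g v := by
  rw [integral_const_mul, integral_sub_right_eq_self fun u ↦ g (l * u),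
    Measure.integral_comp_mul_left, abs_of_pos (inv_pos.2 hl), smul_eq_mul,
    mul_inv_cancel_left₀ hl.ne']

open Topology Set in
theorem tendsto_integral_dilate_of_tendsto_sub_one {B κ : ℝ → ℝ} {C : ℝ} (hBm : Measurable B)
    (hB0 : ∀ u, 0 ≤ B u) (hBC : ∀ u, B u ≤ C) (hBneg : ∀ u, u ≤ 0 → B u = 0)
    (hκ : Integrable κ) {l : ℝ} (hl : 0 < l)
    (h : Tendsto (fun x ↦ ∫ u in Ioi 0, (B u - 1) * (l * κ (l * (u - x)))) atTop (𝓝 0)) :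
    Tendsto (fun x : ℝ ↦ ∫ v, B (x + v / l) * κ v) atTop (𝓝 (∫ v, κ v)) := by
  have hcov : Tendsto (fun x : ℝ ↦ ∫ v in Ioi (-(l * x)), κ v) atTop (𝓝 (∫ v, κ v)) :=
    (aecover_Ioi (tendsto_neg_atTop_atBot.comp
      (tendsto_id.const_mul_atTop hl))).integral_tendsto_of_countably_generated hκ
  have hsum := h.add hcov
  rw [zero_add] at hsum
  refine hsum.congr fun x ↦ ?_
  have hκx : Integrable fun u ↦ l * κ (l * (u - x)) :=
    ((hκ.comp_mul_left' hl.ne').comp_sub_right x).const_mul l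
  have hBκ : Integrable fun u ↦ B u * (l * κ (l * (u - x))) := by
    refine hκx.bdd_mul (c := C) hBm.aestronglyMeasurable (.of_forall fun v ↦ ?_)
    rw [Real.norm_of_nonneg (hB0 _)]
    exact hBC _
  have e1 : ∫ v in Ioi (-(l * x)), κ v = ∫ u in Ioi 0, l * κ (l * (u - x)) := by
    rw [← integral_indicator measurableSet_Ioi, ← integral_comp_mul_sub hl x,
      ← integral_indicator measurableSet_Ioi]
    congr 1 with u
    have : l * (u - x) ∈ Ioi (-(l * x)) ↔ u ∈ Ioi 0 := by
      simp only [mem_Ioi, mul_sub, neg_lt_sub_iff_lt_add, lt_add_iff_pos_right, hl,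
        mul_pos_iff_of_pos_left]
    by_cases hu : u ∈ Ioi 0
    · rw [indicator_of_mem hu, indicator_of_mem (this.2 hu)]
    · rw [indicator_of_notMem hu, indicator_of_notMem (this.not.2 hu), mul_zero]
  have e2 : ∫ v, B (x + v / l) * κ v = ∫ u in Ioi 0, B u * (l * κ (l * (u - x))) := by
    rw [setIntegral_eq_integral_of_forall_compl_eq_zero fun u hu ↦ by
      rw [hBneg u (by simpa using hu), zero_mul], ← integral_comp_mul_sub hl x]
    congr 1 with u
    rw [mul_div_cancel_left₀ _ hl.ne', add_sub_cancel]
    ring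
  simp only [sub_mul, one_mul]
  rw [integral_sub hBκ.integrableOn hκx.integrableOn, e1, e2, sub_add_cancel]

open Complex Topology Chebyshev in
/-- The prime number theorem for `ψ`, in exponential variables. -/
theorem tendsto_psi_exp_mul_exp_neg :
    Tendsto (fun u ↦ psi (rexp u) * rexp (-u)) atTop (𝓝 1) := by
  have hm : Measurable fun u ↦ psi (rexp u) * rexp (-u) := by
    have := psi_mono.measurable
    fun_prop
  refine tendsto_one_of_tendsto_integral_dilate hm psi_exp_mul_exp_neg_nonneg
    psi_exp_mul_exp_neg_le (fun u h hh ↦ ?_) integrable_sinc_half_sq (fun v ↦ by positivity)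
    integral_sinc_half_sq_pos fun l hl ↦ ?_
  · rw [mul_left_comm, ← Real.exp_add, show h + -(u + h) = -u by ring]
    gcongr
    linarith
  · refine tendsto_integral_dilate_of_tendsto_sub_one hm psi_exp_mul_exp_neg_nonneg
      psi_exp_mul_exp_neg_le (fun u hu ↦ ?_) integrable_sinc_half_sq hl ?_
    · rw [psi_eq_zero_of_le_one (Real.exp_le_one_iff.2 hu), zero_mul]
    · obtain ⟨H, hH, hHL⟩ := exists_continuousOn_eq_laplace_psi
      have hk : Continuous fun y : ℝ ↦ ((max 0 (1 - |y / l|) : ℝ) : ℂ) := by fun_prop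
      have hkc : HasCompactSupport fun y : ℝ ↦ ((max 0 (1 - |y / l|) : ℝ) : ℂ) := by
        refine HasCompactSupport.intro (isCompact_Icc (a := -l) (b := l)) fun y hy ↦ ?_
        have : l < |y| := by
          by_contra! h
          exact hy (abs_le.1 h)
        rw [abs_div, abs_of_pos hl, max_eq_left, ofReal_zero]
        rw [sub_nonpos, one_le_div hl]
        exact this.le
      have hK : Integrable fun v : ℝ ↦
          ∫ y : ℝ, ((max 0 (1 - |y / l|) : ℝ) : ℂ) * cexp (-I * y * v) := by
        simp only [integral_scaled_tent_mul_cexp hl]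
        exact ((integrable_sinc_half_sq.comp_mul_left' hl.ne').const_mul l).ofReal
      have hb (u : ℝ) : ‖((psi (rexp u) * rexp (-u) : ℝ) - 1 : ℂ)‖ ≤ Real.log 4 + 4 + 1 := by
        refine (norm_sub_le _ _).trans ?_
        rw [norm_real, Real.norm_of_nonneg (psi_exp_mul_exp_neg_nonneg u), norm_one]
        gcongr
        exact psi_exp_mul_exp_neg_le u
      have hlim := tendsto_integral_mul_fourier (by fun_prop) hb hH hHL hk hkc hK
      rw [← ofReal_zero] at hlim
      refine (tendsto_ofReal_iff.1 (hlim.congr fun x ↦ ?_))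
      rw [← integral_complex_ofReal]
      congr 1 with u
      have := integral_scaled_tent_mul_cexp hl (u - x)
      push_cast at this ⊢
      rw [this]

open Topology Chebyshev in
theorem tendsto_psi_div : Tendsto (fun x ↦ psi x / x) atTop (𝓝 1) := by
  refine (tendsto_psi_exp_mul_exp_neg.comp tendsto_log_atTop).congr' ?_
  filter_upwards [eventually_gt_atTop 0] with x hx
  simp [Real.exp_neg, Real.exp_log hx, div_eq_mul_inv]

open Topology Chebyshev in
theorem tendsto_theta_div : Tendsto (fun x ↦ theta x / x) atTop (𝓝 1) := by
  have h1 : Tendsto (fun x ↦ (psi x - theta x) / x) atTop (𝓝 0) := by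
    refine (isBigO_psi_sub_theta_sqrt.trans_isLittleO ?_).tendsto_div_nhds_zero
    refine (Asymptotics.isLittleO_iff_tendsto' ?_).2 ?_
    · filter_upwards [eventually_ne_atTop 0] with x hx h using absurd h hx
    · exact tendsto_sqrt_atTop.inv_tendsto_atTop.congr fun x ↦ by simp [sqrt_div_self]
  have := tendsto_psi_div.sub h1
  rw [sub_zero] at this
  exact this.congr fun x ↦ by ring

open Topology Chebyshev in
theorem tendsto_primeCounting_div :
    Tendsto (fun x ↦ (Nat.primeCounting ⌊x⌋₊ : ℝ) / (x / log x)) atTop (𝓝 1) := by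
  have h := tendsto_theta_div.add integral_theta_div_log_sq_isLittleO.tendsto_div_nhds_zero
  rw [add_zero] at h
  refine h.congr' ?_
  filter_upwards [eventually_ge_atTop 2] with x hx
  have : 0 < log x := log_pos (by linarith)
  rw [primeCounting_eq_theta_div_log_add_integral hx, add_div]
  congr 1
  field_simp

theorem integral_one_div_log {x : ℝ} (hx : 2 ≤ x) :
    ∫ t in Set.Icc 2 x, 1 / log t = x / log x - 2 / log 2 + ∫ t in 2..x, 1 / log t ^ 2 := by
  have hlog {t : ℝ} (ht : t ∈ Set.uIcc 2 x) : t ≠ 0 ∧ log t ≠ 0 := by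
    rw [Set.uIcc_of_le hx] at ht
    exact ⟨by linarith [ht.1], (log_pos (by linarith [ht.1])).ne'⟩
  have hderiv : ∀ t ∈ Set.uIcc 2 x,
      HasDerivAt (fun t ↦ t / log t) (1 / log t - 1 / log t ^ 2) t := fun t ht ↦ by
    obtain ⟨h0, h1⟩ := hlog ht
    refine ((hasDerivAt_id t).div (hasDerivAt_log h0) h1).congr_deriv ?_
    simp only [id]
    field_simp
  have i1 : IntervalIntegrable (fun t ↦ 1 / log t) volume 2 x :=
    ContinuousOn.intervalIntegrable fun t ht ↦ by
      obtain ⟨h0, h1⟩ := hlog ht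
      exact (continuousAt_const.div (continuousAt_log h0) h1).continuousWithinAt
  have i2 : IntervalIntegrable (fun t ↦ 1 / log t ^ 2) volume 2 x :=
    Chebyshev.intervalIntegrable_one_div_log_sq one_lt_two (by linarith)
  have := intervalIntegral.integral_eq_sub_of_hasDerivAt hderiv (i1.sub i2)
  rw [intervalIntegral.integral_sub i1 i2] at this
  rw [integral_Icc_eq_integral_Ioc, ← intervalIntegral.integral_of_le hx]
  linarith

open Topology in
theorem tendsto_integral_one_div_log_div :
    Tendsto (fun x ↦ (∫ t in Set.Icc 2 x, 1 / log t) / (x / log x)) atTop (𝓝 1) := by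
  have hdiv : Tendsto (fun x ↦ x / log x) atTop atTop := by
    have h : Tendsto (fun x ↦ log x / x) atTop (𝓝[>] 0) := by
      refine tendsto_nhdsWithin_iff.2 ⟨isLittleO_log_id_atTop.tendsto_div_nhds_zero, ?_⟩
      filter_upwards [eventually_gt_atTop 1] with x hx
      exact div_pos (log_pos hx) (by linarith)
    simpa [Function.comp_def] using tendsto_inv_nhdsGT_zero.comp h
  have h1 : (fun x ↦ ∫ t in 2..x, 1 / log t ^ 2) =o[atTop] fun x ↦ x / log x := by
    refine Chebyshev.integral_one_div_log_sq_isBigO.trans_isLittleO ?_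
    have : (fun x ↦ x / log x * (log x)⁻¹) =o[atTop] fun x ↦ x / log x * 1 :=
      (Asymptotics.isBigO_refl _ _).mul_isLittleO
        ((Asymptotics.isLittleO_one_iff ℝ).2 tendsto_log_atTop.inv_tendsto_atTop)
    refine this.congr (fun x ↦ ?_) (fun x ↦ mul_one _)
    ring
  have h := ((tendsto_const_nhds (x := (1 : ℝ))).sub
    (hdiv.const_div_atTop (2 / log 2))).add h1.tendsto_div_nhds_zero
  rw [sub_zero, add_zero] at h
  refine h.congr' ?_
  filter_upwards [eventually_ge_atTop 2] with x hx
  have : 0 < log x := log_pos (by linarith)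
  rw [integral_one_div_log hx, add_div, sub_div, div_self (by positivity)]

theorem pi_asymp :
    ∃ c : ℝ → ℝ, c =o[atTop] (fun _ ↦ (1 : ℝ)) ∧
      ∀ᶠ x : ℝ in atTop,
        (Nat.primeCounting ⌊x⌋₊ : ℝ) = (1 + c x) * ∫ t in Set.Icc 2 x, 1 / Real.log t ∂volume := by
  have hratio := tendsto_primeCounting_div.div tendsto_integral_one_div_log_div one_ne_zero
  rw [div_one] at hratio
  refine ⟨fun x ↦ (Nat.primeCounting ⌊x⌋₊ : ℝ) / (∫ t in Set.Icc 2 x, 1 / log t) - 1,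
    (Asymptotics.isLittleO_one_iff ℝ).2 ?_, ?_⟩
  · rw [← sub_self (1 : ℝ)]
    refine (hratio.congr' ?_).sub_const 1
    filter_upwards [eventually_ge_atTop 2] with x hx
    have : 0 < log x := log_pos (by linarith)
    exact div_div_div_cancel_right₀ (by positivity) _ _
  · filter_upwards [tendsto_integral_one_div_log_div.eventually_ne one_ne_zero] with x hx
    rw [add_sub_cancel, div_mul_cancel₀]
    exact (div_ne_zero_iff.1 hx).1
end

section
/- For all sufficiently large natural numbers n, one has d_n³ ≤ 21ⁿ, where d_n := lcm{1, 2, …, n}. -/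
open Filter

/-- `d n = lcm {1, 2, …, n}`. -/
def d (n : ℕ) : ℕ := (Finset.Icc 1 n).lcm id

open MeasureTheory Set Topology

/-- The (unnormalised) Fejér kernel, `(1 - cos v) / v ^ 2` away from `0`. -/
noncomputable def fejer (v : ℝ) : ℝ := ∫ t in (0 : ℝ)..1, (1 - t) * Real.cos (t * v)

lemma sq_mul_fejer (v : ℝ) : v ^ 2 * fejer v = 1 - Real.cos v := by
  have h : ∀ t ∈ uIcc (0 : ℝ) 1, HasDerivAt
      (fun t => (1 - t) * (v * Real.sin (t * v)) - Real.cos (t * v))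
      (v ^ 2 * ((1 - t) * Real.cos (t * v))) t := by
    intro t _
    have h1 : HasDerivAt (fun t : ℝ => t * v) v t := by
      simpa using (hasDerivAt_id t).mul_const v
    have h2 : HasDerivAt (fun t : ℝ => 1 - t) (-1) t := by
      simpa using (hasDerivAt_id t).const_sub 1
    convert! (h2.mul (h1.sin.const_mul v)).sub h1.cos using 1
    ring
  rw [fejer, ← intervalIntegral.integral_const_mul,
    intervalIntegral.integral_eq_sub_of_hasDerivAt h
      (Continuous.intervalIntegrable (by fun_prop) _ _)]
  simp
  ring

lemma fejer_zero : fejer 0 = 1 / 2 := by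
  have : (∫ t in (0 : ℝ)..1, (1 - t)) = 1 / 2 := by
    rw [intervalIntegral.integral_sub (by simp) (by simp)]
    norm_num
  simpa [fejer] using this

lemma fejer_nonneg (v : ℝ) : 0 ≤ fejer v := by
  rcases eq_or_ne v 0 with rfl | hv
  · norm_num [fejer_zero]
  · have := sq_mul_fejer v
    have := Real.cos_le_one v
    exact nonneg_of_mul_nonneg_right (by linarith : 0 ≤ v ^ 2 * fejer v) (by positivity)

lemma fejer_le_one (v : ℝ) : fejer v ≤ 1 := by
  have h := intervalIntegral.norm_integral_le_of_norm_le_const (a := (0 : ℝ)) (b := 1) (C := 1)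
    (f := fun t => (1 - t) * Real.cos (t * v)) fun t ht => by
      rw [uIoc_of_le zero_le_one] at ht
      rw [norm_mul, Real.norm_eq_abs, Real.norm_eq_abs]
      exact mul_le_one₀ (abs_le.mpr ⟨by linarith [ht.2], by linarith [ht.1]⟩) (abs_nonneg _)
        (Real.abs_cos_le_one _)
  simpa [fejer] using (le_abs_self _).trans h

lemma fejer_le (v : ℝ) : fejer v ≤ 3 * (1 + v ^ 2)⁻¹ := by
  rw [← div_eq_mul_inv, le_div_iff₀ (by positivity)]
  linarith [sq_mul_fejer v, fejer_le_one v, Real.neg_one_le_cos v]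

lemma continuous_fejer : Continuous fejer :=
  intervalIntegral.continuous_parametric_intervalIntegral_of_continuous' (by fun_prop) 0 1

lemma integrable_fejer : Integrable fejer :=
  (integrable_inv_one_add_sq.const_mul 3).mono' continuous_fejer.aestronglyMeasurable
    (.of_forall fun v => by simpa [abs_of_nonneg (fejer_nonneg v)] using fejer_le v)

lemma integral_fejer_pos : 0 < ∫ v, fejer v :=
  integral_pos_of_integrable_nonneg_nonzero (x := 0) continuous_fejer integrable_fejer
    fejer_nonneg (by norm_num [fejer_zero])

lemma integrable_fejer_comp {a : ℝ} (ha : 0 < a) (y : ℝ) :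
    Integrable fun u => fejer (a * (y - u)) :=
  (integrable_fejer.comp_mul_left' ha.ne').comp_sub_left y

lemma integral_fejer_comp {a : ℝ} (ha : 0 < a) (y : ℝ) :
    ∫ u, fejer (a * (y - u)) = a⁻¹ * ∫ v, fejer v := by
  rw [integral_sub_left_eq_self (fun u => fejer (a * u)) volume y,
    Measure.integral_comp_mul_left]
  simp [abs_of_pos ha]

lemma intervalIntegral_fejer_comp {a : ℝ} (ha : 0 < a) (y δ : ℝ) :
    ∫ u in (y - δ)..(y + δ), fejer (a * (y - u)) = a⁻¹ * ∫ v in -(a * δ)..a * δ, fejer v := by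
  rw [intervalIntegral.integral_comp_sub_left (fun u => fejer (a * u)) y,
    intervalIntegral.integral_comp_mul_left _ ha.ne']
  simp

lemma fourier_identity {r : ℝ → ℝ} (hr : Measurable r) {C : ℝ} (hC : ∀ u, |r u| ≤ C)
    {a ε : ℝ} (hε : 0 < ε) (y : ℝ) :
    ∫ u in Ioi (0 : ℝ), r u * Real.exp (-ε * u) * fejer (a * (y - u)) =
      (∫ t in (0 : ℝ)..1, (1 - t) * Complex.exp (t * a * y * Complex.I) *
        ∫ u in Ioi (0 : ℝ), (r u : ℂ) * Complex.exp (-(ε + a * t * Complex.I) * u)).re := by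
  have hexp : Integrable (fun u : ℝ => C * Real.exp (-ε * u)) (volume.restrict (Ioi 0)) :=
    (exp_neg_integrableOn_Ioi 0 hε).const_mul C
  let F : ℝ → ℝ → ℂ := fun t u => (1 - t) * Complex.exp (t * a * y * Complex.I) *
    ((r u : ℂ) * Complex.exp (-(ε + a * t * Complex.I) * u))
  have hF : ∀ t u, F t u = ((r u * Real.exp (-ε * u) : ℝ) : ℂ) *
      (((1 - t : ℝ) : ℂ) * Complex.exp ((t * (a * (y - u)) : ℝ) * Complex.I)) := by
    intro t u
    simp only [F]
    push_cast
    rw [show -((ε : ℂ) + a * t * Complex.I) * u = -ε * u + -(a * t * u * Complex.I) by ring,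
      Complex.exp_add, show ((t : ℂ) * (a * (y - u))) * Complex.I =
        t * a * y * Complex.I + -(a * t * u * Complex.I) by ring, Complex.exp_add]
    ring
  have hFint : Integrable (Function.uncurry F)
      ((volume.restrict (Ioc (0 : ℝ) 1)).prod (volume.restrict (Ioi (0 : ℝ)))) := by
    have h1 : Integrable (fun _ : ℝ => (1 : ℝ)) (volume.restrict (Ioc (0 : ℝ) 1)) :=
      integrable_const _
    refine (h1.mul_prod hexp).mono' ?_ ?_
    · refine Measurable.aestronglyMeasurable ?_
      have : Measurable fun p : ℝ × ℝ => (r p.2 : ℂ) :=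
        Complex.measurable_ofReal.comp (hr.comp measurable_snd)
      simp only [F, Function.uncurry_def]
      fun_prop
    · rw [Measure.prod_restrict]
      refine (ae_restrict_mem (measurableSet_Ioc.prod measurableSet_Ioi)).mono ?_
      rintro ⟨t, u⟩ ⟨ht, _⟩
      simp only [Function.uncurry_apply_pair, hF, norm_mul, Complex.norm_real,
        Complex.norm_exp_ofReal_mul_I, mul_one, one_mul, Real.norm_eq_abs, Real.abs_exp]
      have h2 : |1 - t| ≤ 1 := abs_le.mpr ⟨by linarith [ht.2], by linarith [ht.1]⟩
      have h3 := hC u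
      have h4 := (abs_nonneg _).trans h3
      calc |r u| * Real.exp (-ε * u) * |1 - t| ≤ C * Real.exp (-ε * u) * 1 := by gcongr
        _ = _ := mul_one _
  have hre : ∀ u, (∫ t in Ioc (0 : ℝ) 1, F t u).re =
      r u * Real.exp (-ε * u) * fejer (a * (y - u)) := by
    intro u
    simp only [hF]
    rw [integral_const_mul, Complex.re_ofReal_mul, fejer,
      intervalIntegral.integral_of_le zero_le_one]
    congr 1
    rw [← RCLike.re_eq_complex_re, ← integral_re]
    · refine integral_congr_ae (.of_forall fun t => ?_)
      simp only [RCLike.re_eq_complex_re, Complex.re_ofReal_mul, Complex.exp_ofReal_mul_I_re]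
    · exact (Continuous.integrableOn_Ioc (by fun_prop))
  have hswap := integral_integral_swap hFint
  calc _ = ∫ u in Ioi (0 : ℝ), (∫ t in Ioc (0 : ℝ) 1, F t u).re := by simp only [hre]
    _ = (∫ u in Ioi (0 : ℝ), ∫ t in Ioc (0 : ℝ) 1, F t u).re := by
      simp only [← RCLike.re_eq_complex_re]
      exact integral_re hFint.integral_prod_right
    _ = _ := by
      rw [← hswap, intervalIntegral.integral_of_le zero_le_one]
      simp only [F, integral_const_mul]

/-- A form of the Riemann-Lebesgue lemma. -/
lemma tendsto_fourier {h : ℝ → ℂ} {a : ℝ} (ha : 0 < a) :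
    Tendsto (fun y : ℝ => ∫ t in (0 : ℝ)..1, (1 - t) * Complex.exp (t * a * y * Complex.I) * h t)
      atTop (𝓝 0) := by
  have h1 := Real.tendsto_integral_exp_smul_cocompact
    ((Ioc (0 : ℝ) 1).indicator fun t => (1 - t) * h t)
  have h2 : Tendsto (fun y : ℝ => y * (-(a / (2 * Real.pi)))) atTop (cocompact ℝ) :=
    ((tendsto_id.atTop_mul_const_of_neg (by simp; positivity))).mono_right atBot_le_cocompact
  refine (h1.comp h2).congr fun y => ?_
  rw [intervalIntegral.integral_of_le zero_le_one, ← integral_indicator measurableSet_Ioc]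
  refine integral_congr_ae (.of_forall fun t => ?_)
  by_cases ht : t ∈ Ioc (0 : ℝ) 1
  · simp only [ht, indicator_of_mem, Circle.smul_def, Real.fourierChar_apply, smul_eq_mul]
    have : ((2 * Real.pi * -(t * (y * -(a / (2 * Real.pi)))) : ℝ) : ℂ) = t * a * y := by
      rw [← Complex.ofReal_mul, ← Complex.ofReal_mul]
      congr 1
      field_simp
    rw [this]
    ring
  · simp [ht]

/-- If the Laplace transform of a bounded function extends continuously to the closed right
half-plane, then its averages against a translated Fejér kernel tend to zero. -/
lemma tendsto_integral_mul_fejer {r : ℝ → ℝ} (hr : Measurable r) {C : ℝ} (hC : ∀ u, |r u| ≤ C)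
    {g : ℂ → ℂ} (hg : ContinuousOn g {z | 0 ≤ z.re})
    (hrg : ∀ z : ℂ, 0 < z.re → ∫ u in Ioi (0 : ℝ), (r u : ℂ) * Complex.exp (-z * u) = g z)
    {a : ℝ} (ha : 0 < a) :
    Tendsto (fun y => ∫ u in Ioi (0 : ℝ), r u * fejer (a * (y - u))) atTop (𝓝 0) := by
  have key : ∀ y : ℝ, ∫ u in Ioi (0 : ℝ), r u * fejer (a * (y - u)) =
      (∫ t in (0 : ℝ)..1, (1 - t) * Complex.exp (t * a * y * Complex.I) *
        g (a * t * Complex.I)).re := by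
    intro y
    have hl : Tendsto (fun ε : ℝ => ∫ u in Ioi (0 : ℝ),
        r u * Real.exp (-ε * u) * fejer (a * (y - u))) (𝓝[>] 0)
        (𝓝 (∫ u in Ioi (0 : ℝ), r u * fejer (a * (y - u)))) := by
      refine tendsto_integral_filter_of_dominated_convergence
        (fun u => C * fejer (a * (y - u))) ?_ ?_ ?_ ?_
      · refine .of_forall fun ε => Measurable.aestronglyMeasurable ?_
        have := continuous_fejer.measurable
        fun_prop
      · filter_upwards [self_mem_nhdsWithin] with ε hε
        refine (ae_restrict_mem measurableSet_Ioi).mono fun u hu => ?_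
        rw [norm_mul, norm_mul, Real.norm_eq_abs, Real.norm_eq_abs, Real.norm_eq_abs, Real.abs_exp,
          abs_of_nonneg (fejer_nonneg _)]
        have h1 : Real.exp (-ε * u) ≤ 1 := by
          rw [Real.exp_le_one_iff]
          nlinarith [mem_Ioi.1 hε, mem_Ioi.1 hu]
        have h3 := hC u
        have h4 := (abs_nonneg _).trans h3
        gcongr ?_ * _
        · exact fejer_nonneg _
        calc |r u| * Real.exp (-ε * u) ≤ C * 1 := by gcongr
          _ = C := mul_one C
      · exact ((integrable_fejer_comp ha y).const_mul C).integrableOn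
      · refine .of_forall fun u => tendsto_nhdsWithin_of_tendsto_nhds ?_
        have : Continuous fun ε : ℝ => r u * Real.exp (-ε * u) * fejer (a * (y - u)) := by
          fun_prop
        simpa using this.tendsto 0
    have hcont : ContinuousOn (fun p : ℝ × ℝ => g (p.1 + a * p.2 * Complex.I))
        (Icc (0 : ℝ) 1 ×ˢ Icc (0 : ℝ) 1) := by
      refine hg.comp (by fun_prop) ?_
      rintro ⟨ε, t⟩ ⟨hε, _⟩
      simpa using hε.1
    obtain ⟨M, hM⟩ := (isCompact_Icc.prod isCompact_Icc).exists_bound_of_continuousOn hcont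
    have hslice : ∀ ε ∈ Icc (0 : ℝ) 1,
        ContinuousOn (fun t : ℝ => g (ε + a * t * Complex.I)) (Icc 0 1) := fun ε hε =>
      hcont.comp (f := fun t : ℝ => (ε, t)) (by fun_prop) fun t ht => ⟨hε, ht⟩
    have hr' : Tendsto (fun ε : ℝ => ∫ t in (0 : ℝ)..1,
        (1 - t) * Complex.exp (t * a * y * Complex.I) * g (ε + a * t * Complex.I)) (𝓝[>] 0)
        (𝓝 (∫ t in (0 : ℝ)..1, (1 - t) * Complex.exp (t * a * y * Complex.I) *
          g (a * t * Complex.I))) := by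
      have hmem : ∀ᶠ ε : ℝ in 𝓝[>] 0, ε ∈ Icc (0 : ℝ) 1 :=
        mem_of_superset (Ioc_mem_nhdsGT zero_lt_one) Ioc_subset_Icc_self
      refine intervalIntegral.tendsto_integral_filter_of_dominated_convergence
        (fun _ => M) ?_ ?_ (by simp) ?_
      · filter_upwards [hmem] with ε hε
        rw [uIoc_of_le zero_le_one]
        refine ContinuousOn.aestronglyMeasurable ?_ measurableSet_Ioc
        exact ContinuousOn.mul (by fun_prop) ((hslice ε hε).mono Ioc_subset_Icc_self)
      · filter_upwards [hmem] with ε hε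
        refine .of_forall fun t ht => ?_
        rw [uIoc_of_le zero_le_one] at ht
        have h1 := hM (ε, t) ⟨hε, Ioc_subset_Icc_self ht⟩
        have h2 : ‖(1 - t : ℂ)‖ ≤ 1 := by
          rw [← Complex.ofReal_one, ← Complex.ofReal_sub, Complex.norm_real]
          exact abs_le.mpr ⟨by linarith [ht.2], by linarith [ht.1]⟩
        have h3 : ‖Complex.exp (t * a * y * Complex.I)‖ = 1 := by
          exact_mod_cast Complex.norm_exp_ofReal_mul_I (t * a * y)
        rw [norm_mul, norm_mul, h3, mul_one]
        calc _ ≤ 1 * M := by gcongr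
          _ = M := one_mul M
      · refine .of_forall fun t ht => ?_
        rw [uIoc_of_le zero_le_one] at ht
        refine Tendsto.const_mul _ ?_
        have h1 : Tendsto (fun ε : ℝ => (ε + a * t * Complex.I : ℂ)) (𝓝[>] 0)
            (𝓝[{z | 0 ≤ z.re}] (a * t * Complex.I)) := by
          refine tendsto_nhdsWithin_iff.mpr ⟨tendsto_nhdsWithin_of_tendsto_nhds ?_, ?_⟩
          · have : Continuous fun ε : ℝ => (ε + a * t * Complex.I : ℂ) := by fun_prop
            simpa using this.tendsto 0
          · filter_upwards [self_mem_nhdsWithin] with ε hε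
            simpa using (mem_Ioi.1 hε).le
        exact (hg _ (by simp)).tendsto.comp h1
    refine tendsto_nhds_unique hl
      (((Complex.continuous_re.tendsto _).comp hr').congr' ?_)
    filter_upwards [self_mem_nhdsWithin] with ε hε
    rw [fourier_identity hr hC hε y, Function.comp_apply]
    have hz : ∀ t : ℝ, 0 < ((ε : ℂ) + a * t * Complex.I).re := fun t => by simpa using hε
    simp only [hrg _ (hz _)]
  simp_rw [key]
  simpa [Function.comp_def] using (Complex.continuous_re.tendsto _).comp
    (tendsto_fourier (h := fun t => g (a * t * Complex.I)) ha)

open Chebyshev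

/-- The Laplace transform of `ψ (exp u) * exp (-u)`. -/
lemma psi_laplace {z : ℂ} (hz : 0 < z.re) :
    ∫ u in Ioi (0 : ℝ), ((psi (Real.exp u) * Real.exp (-u) : ℝ) : ℂ) * Complex.exp (-z * u) =
      LSeries (fun n => (ArithmeticFunction.vonMangoldt n : ℂ)) (1 + z) / (1 + z) := by
  have hsum : ∀ n : ℕ, ∑ k ∈ Finset.Icc 1 n, ArithmeticFunction.vonMangoldt k = psi n := by
    intro n
    rw [psi, Nat.floor_natCast]
    rfl
  have hO : (fun n : ℕ => ∑ k ∈ Finset.Icc 1 n, ArithmeticFunction.vonMangoldt k) =O[atTop]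
      fun n => (n : ℝ) ^ (1 : ℝ) := by
    refine Asymptotics.IsBigO.of_bound (Real.log 4 + 4) (.of_forall fun n => ?_)
    rw [hsum, Real.rpow_one, Real.norm_of_nonneg (psi_nonneg _), Real.norm_of_nonneg (by simp)]
    exact psi_le_const_mul_self (by simp)
  have hne : 1 + z ≠ 0 := fun h => by
    have := congrArg Complex.re h
    simp at this
    linarith
  rw [LSeries_eq_mul_integral_of_nonneg _ zero_le_one (by simpa using hz) hO
    (fun n => ArithmeticFunction.vonMangoldt_nonneg), mul_div_cancel_left₀ _ hne,
    ← Real.exp_zero, ← integral_comp_exp_Ioi]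
  refine integral_congr_ae (.of_forall fun u => ?_)
  have h1 : (∑ k ∈ Finset.Icc 1 ⌊Real.exp u⌋₊, (ArithmeticFunction.vonMangoldt k : ℂ)) =
      (psi (Real.exp u) : ℂ) := by
    rw [← Complex.ofReal_sum, hsum, ← psi_eq_psi_coe_floor]
  simp only [Complex.real_smul]
  rw [h1, Complex.cpow_def_of_ne_zero (by simp), Complex.ofReal_exp,
    Complex.log_exp (by simp [Real.pi_pos]) (by simp [Real.pi_pos.le]),
    mul_left_comm, ← Complex.exp_add, Complex.ofReal_mul, mul_assoc, Complex.ofReal_exp,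
    ← Complex.exp_add]
  congr 2
  push_cast
  ring

lemma psi_mul_exp_neg_le (u : ℝ) : psi (Real.exp u) * Real.exp (-u) ≤ Real.log 4 + 4 := by
  rw [Real.exp_neg, ← div_eq_mul_inv, div_le_iff₀ (Real.exp_pos u)]
  exact psi_le_const_mul_self (Real.exp_pos u).le

lemma psi_mul_exp_neg_nonneg (u : ℝ) : 0 ≤ psi (Real.exp u) * Real.exp (-u) :=
  mul_nonneg (psi_nonneg _) (Real.exp_pos _).le

lemma measurable_psi_mul_exp_neg : Measurable fun u => psi (Real.exp u) * Real.exp (-u) :=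
  (psi_mono.measurable.comp Real.measurable_exp).mul (by fun_prop)

lemma abs_psi_mul_exp_neg_sub_one_le (u : ℝ) :
    |psi (Real.exp u) * Real.exp (-u) - 1| ≤ Real.log 4 + 4 := by
  have := Real.log_nonneg (show (1 : ℝ) ≤ 4 by norm_num)
  exact abs_le.mpr ⟨by linarith [psi_mul_exp_neg_nonneg u], by linarith [psi_mul_exp_neg_le u]⟩

lemma integrableOn_exp_neg_mul {z : ℂ} (hz : 0 < z.re) :
    IntegrableOn (fun u : ℝ => Complex.exp (-z * u)) (Ioi 0) :=
  integrableOn_exp_mul_complex_Ioi (by simpa using hz) 0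

lemma exists_continuousOn_laplace :
    ∃ g : ℂ → ℂ, ContinuousOn g {z | 0 ≤ z.re} ∧ ∀ z : ℂ, 0 < z.re →
      ∫ u in Ioi (0 : ℝ), ((psi (Real.exp u) * Real.exp (-u) - 1 : ℝ) : ℂ) * Complex.exp (-z * u) =
        g z := by
  let G := ArithmeticFunction.vonMangoldt.LFunctionResidueClassAux (q := 1) 1
  have hne : ∀ z : ℂ, 0 ≤ z.re → 1 + z ≠ 0 := fun z hz h => by
    have := congrArg Complex.re h
    simp at this
    linarith
  refine ⟨fun z => (G (1 + z) - 1) / (1 + z), ?_, fun z hz => ?_⟩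
  · refine ContinuousOn.div ?_ (by fun_prop) fun z hz => hne z hz
    refine ContinuousOn.sub ?_ continuousOn_const
    refine (ArithmeticFunction.vonMangoldt.continuousOn_LFunctionResidueClassAux 1).comp
      (by fun_prop) fun z hz => ?_
    simpa using hz
  · have hz0 : z ≠ 0 := fun h => by simp [h] at hz
    have hG : G (1 + z) =
        LSeries (fun n => (ArithmeticFunction.vonMangoldt n : ℂ)) (1 + z) - 1 / z := by
      have h := ArithmeticFunction.vonMangoldt.eqOn_LFunctionResidueClassAux (q := 1) (a := 1)
        isUnit_one (show (1 + z) ∈ {s : ℂ | 1 < s.re} by simpa using hz)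
      have hr : ArithmeticFunction.vonMangoldt.residueClass (1 : ZMod 1) =
          fun n => ArithmeticFunction.vonMangoldt n := by
        ext n
        simp [ArithmeticFunction.vonMangoldt.residueClass, Subsingleton.elim _ (1 : ZMod 1)]
      simpa [G, hr] using h
    have hE := integrableOn_exp_neg_mul hz
    have hS : IntegrableOn (fun u : ℝ =>
        ((psi (Real.exp u) * Real.exp (-u) : ℝ) : ℂ) * Complex.exp (-z * u)) (Ioi 0) :=
      Integrable.bdd_mul hE
        (Complex.measurable_ofReal.comp measurable_psi_mul_exp_neg).aestronglyMeasurable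
        (c := Real.log 4 + 4) (.of_forall fun u => by
          rw [Complex.norm_real, Real.norm_of_nonneg (psi_mul_exp_neg_nonneg u)]
          exact psi_mul_exp_neg_le u)
    have h1 : ∫ u in Ioi (0 : ℝ), Complex.exp (-z * u) = 1 / z := by
      rw [integral_exp_mul_complex_Ioi (by simpa using hz)]
      simp
    simp only [Complex.ofReal_sub, Complex.ofReal_one, sub_mul, one_mul]
    rw [integral_sub hS hE, psi_laplace hz, h1, hG]
    have := hne z hz.le
    field_simp
    ring

/-- The upper half of the prime number theorem. -/
theorem eventually_psi_exp_le {b : ℝ} (hb : 1 < b) :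
    ∀ᶠ x : ℝ in atTop, psi (Real.exp x) ≤ b ^ 3 * Real.exp x := by
  set δ := Real.log b / 2 with hδ
  have hb0 : 0 < b := by linarith
  have hδ0 : 0 < δ := half_pos (Real.log_pos hb)
  have hexp : Real.exp (-(2 * δ)) = b⁻¹ := by
    rw [hδ, mul_div_cancel₀ _ two_ne_zero, Real.exp_neg, Real.exp_log hb0]
  set I := ∫ v, fejer v with hI
  have hI0 : 0 < I := integral_fejer_pos
  obtain ⟨a, ha, haJ⟩ : ∃ a : ℝ, 0 < a ∧ I / b < ∫ v in -(a * δ)..a * δ, fejer v := by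
    have h1 : Tendsto (fun a : ℝ => a * δ) atTop atTop := tendsto_id.atTop_mul_const hδ0
    have h2 := intervalIntegral_tendsto_integral integrable_fejer
      (tendsto_neg_atTop_atBot.comp h1) h1
    exact ((eventually_gt_atTop 0).and
      (h2.eventually (lt_mem_nhds (div_lt_self hI0 hb)))).exists
  set S : ℝ → ℝ := fun u => psi (Real.exp u) * Real.exp (-u) with hS
  obtain ⟨g, hg, hrg⟩ := exists_continuousOn_laplace
  have hlim := tendsto_integral_mul_fejer (measurable_psi_mul_exp_neg.sub_const 1)
    abs_psi_mul_exp_neg_sub_one_le hg hrg ha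
  have hsmall := hlim.eventually (gt_mem_nhds (show 0 < (b - 1) * (a⁻¹ * I) by
    have := sub_pos.mpr hb
    positivity))
  have hshift : Tendsto (fun x : ℝ => x + δ) atTop atTop :=
    tendsto_atTop_add_const_right _ _ tendsto_id
  filter_upwards [hshift.eventually hsmall, eventually_gt_atTop 0] with x hx hx0
  set y := x + δ with hy
  have hΦ := integrable_fejer_comp ha y
  have hSΦ : Integrable fun u => S u * fejer (a * (y - u)) :=
    hΦ.bdd_mul measurable_psi_mul_exp_neg.aestronglyMeasurable (c := Real.log 4 + 4)
      (.of_forall fun u => by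
        rw [Real.norm_of_nonneg (psi_mul_exp_neg_nonneg u)]
        exact psi_mul_exp_neg_le u)
  have hupper : ∫ u in Ioi (0 : ℝ), S u * fejer (a * (y - u)) ≤ b * (a⁻¹ * I) := by
    have h1 : ∫ u in Ioi (0 : ℝ), fejer (a * (y - u)) ≤ a⁻¹ * I := by
      rw [hI, ← integral_fejer_comp ha y]
      exact setIntegral_le_integral hΦ (.of_forall fun _ => fejer_nonneg _)
    have h2 : ∫ u in Ioi (0 : ℝ), (S u - 1) * fejer (a * (y - u)) =
        (∫ u in Ioi (0 : ℝ), S u * fejer (a * (y - u))) -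
          ∫ u in Ioi (0 : ℝ), fejer (a * (y - u)) := by
      simp only [sub_mul, one_mul]
      exact integral_sub hSΦ.integrableOn hΦ.integrableOn
    linarith
  have hlower : S x * b⁻¹ * (a⁻¹ * ∫ v in -(a * δ)..a * δ, fejer v) ≤
      ∫ u in Ioi (0 : ℝ), S u * fejer (a * (y - u)) := by
    rw [← intervalIntegral_fejer_comp ha y δ, intervalIntegral.integral_of_le (by linarith),
      ← integral_const_mul]
    calc _ ≤ ∫ u in Ioc (y - δ) (y + δ), S u * fejer (a * (y - u)) := by
          refine setIntegral_mono_on (hΦ.const_mul _).integrableOn hSΦ.integrableOn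
            measurableSet_Ioc fun u hu => ?_
          refine mul_le_mul_of_nonneg_right ?_ (fejer_nonneg _)
          rw [← hexp, hS]
          simp only
          rw [mul_assoc, ← Real.exp_add]
          have h1 : x ≤ u := by linarith [hu.1]
          have h2 : -x + -(2 * δ) ≤ -u := by linarith [hu.2]
          exact mul_le_mul (psi_mono (Real.exp_le_exp.mpr h1)) (Real.exp_le_exp.mpr h2)
            (Real.exp_pos _).le (psi_nonneg _)
      _ ≤ _ := by
          refine setIntegral_mono_set hSΦ.integrableOn
            (.of_forall fun u => mul_nonneg (psi_mul_exp_neg_nonneg u) (fejer_nonneg _))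
            (LE.le.eventuallyLE fun u hu => ?_)
          exact mem_Ioi.mpr (by linarith [hu.1])
  have hSx : 0 ≤ S x := psi_mul_exp_neg_nonneg x
  have h3 : S x * b⁻¹ * (a⁻¹ * (I / b)) ≤ b * (a⁻¹ * I) := by
    refine le_trans ?_ (hlower.trans hupper)
    gcongr
  have h4 : S x ≤ b ^ 3 := by
    have h5 : S x * b⁻¹ * (a⁻¹ * (I / b)) = S x / b ^ 2 * (a⁻¹ * I) := by
      field_simp
    rw [h5, mul_le_mul_iff_left₀ (by positivity), div_le_iff₀ (by positivity)] at h3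
    linarith [h3]
  rw [hS] at h4
  simp only [Real.exp_neg] at h4
  rwa [← div_eq_mul_inv, div_le_iff₀ (Real.exp_pos x)] at h4

theorem dn_cube_le_eventually : ∀ᶠ n : ℕ in atTop, d n ^ 3 ≤ 21 ^ n := by
  have h := (Real.tendsto_log_atTop.comp tendsto_natCast_atTop_atTop).eventually
    (eventually_psi_exp_le (b := 1003 / 1000) (by norm_num))
  filter_upwards [h, eventually_gt_atTop 0] with n hn hn0
  have hn0' : (0 : ℝ) < n := by exact_mod_cast hn0
  rw [Function.comp_apply, Real.exp_log hn0', psi_eq_log_lcmUpto] at hn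
  have hd : d n = Nat.lcmUpto n := rfl
  have hpos : (0 : ℝ) < d n := by exact_mod_cast hd ▸ Nat.lcmUpto_pos n
  rw [← hd] at hn
  have h21 : (303 / 100 : ℝ) ≤ Real.log 21 := by
    rw [Real.le_log_iff_exp_le (by norm_num)]
    refine le_of_pow_le_pow_left₀ (n := 100) (by norm_num) (by norm_num) ?_
    rw [← Real.exp_nat_mul, show ((100 : ℕ) : ℝ) * (303 / 100) = (303 : ℕ) * 1 by norm_num,
      Real.exp_nat_mul]
    have he : Real.exp 1 ^ 3 ≤ 201 / 10 :=
      (pow_le_pow_left₀ (Real.exp_pos 1).le Real.exp_one_lt_d9.le 3).trans (by norm_num)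
    rw [show 303 = 3 * 101 by norm_num, pow_mul]
    exact (pow_le_pow_left₀ (by positivity) he 101).trans (by norm_num)
  have hreal : (d n : ℝ) ^ 3 ≤ 21 ^ n := by
    rw [← Real.log_le_log_iff (by positivity) (by positivity), Real.log_pow, Real.log_pow]
    push_cast
    nlinarith
  exact_mod_cast hreal
end

section
/- For all natural numbers r, s, k, the lower Lebesgue integral over (0,1)² of ENNReal.ofReal(−log(xy) · x^{k+r} · y^{k+s}) equals ENNReal.ofReal(1/((k+r+1)² (k+s+1)) + 1/((k+r+1)(k+s+1)²)). -/
open MeasureTheory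

/-- The fundamental theorem of calculus for a nonnegative derivative, as a lower integral. -/
theorem lintegral_Ioo_ofReal_of_hasDerivAt {a b : ℝ} (hab : a ≤ b) {g g' : ℝ → ℝ}
    (hg : ContinuousOn g (Set.Icc a b)) (hd : ∀ x ∈ Set.Ioo a b, HasDerivAt g (g' x) x)
    (hpos : ∀ x ∈ Set.Ioo a b, 0 ≤ g' x) :
    ∫⁻ x in Set.Ioo a b, ENNReal.ofReal (g' x) = ENNReal.ofReal (g b - g a) := by
  have hi : IntegrableOn g' (Set.Ioc a b) :=
    intervalIntegral.integrableOn_deriv_of_nonneg hg hd hpos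
  rw [← intervalIntegral.integral_eq_sub_of_hasDerivAt_of_le hab hg hd
      ((intervalIntegrable_iff_integrableOn_Ioc_of_le hab).2 hi),
    intervalIntegral.integral_of_le hab, integral_Ioc_eq_integral_Ioo,
    ofReal_integral_eq_lintegral_ofReal (hi.mono_set Set.Ioo_subset_Ioc_self)
      ((ae_restrict_mem measurableSet_Ioo).mono hpos)]

theorem lintegral_Ioo_zero_one_pow (n : ℕ) :
    ∫⁻ x in Set.Ioo (0 : ℝ) 1, ENNReal.ofReal (x ^ n) = ENNReal.ofReal (1 / ((n : ℝ) + 1)) := by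
  have hn : (n : ℝ) + 1 ≠ 0 := by positivity
  rw [lintegral_Ioo_ofReal_of_hasDerivAt (g := fun x => x ^ (n + 1) / ((n : ℝ) + 1))
    zero_le_one (by fun_prop)]
  · simp
  · intro x _
    refine ((hasDerivAt_pow (n + 1) x).div_const ((n : ℝ) + 1)).congr_deriv ?_
    push_cast
    field_simp
  · exact fun x hx => pow_nonneg hx.1.le n

theorem lintegral_Ioo_zero_one_neg_log_mul_pow (n : ℕ) :
    ∫⁻ x in Set.Ioo (0 : ℝ) 1, ENNReal.ofReal (-Real.log x * x ^ n) =
      ENNReal.ofReal (1 / ((n : ℝ) + 1) ^ 2) := by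
  have hn : (n : ℝ) + 1 ≠ 0 := by positivity
  rw [lintegral_Ioo_ofReal_of_hasDerivAt
    (g := fun x => x ^ (n + 1) / ((n : ℝ) + 1) ^ 2 - x ^ (n + 1) * Real.log x / ((n : ℝ) + 1))
    zero_le_one]
  · simp
  · have hc : Continuous fun x : ℝ => x ^ (n + 1) * Real.log x := by
      simp only [pow_succ, mul_assoc]
      exact (continuous_pow n).mul Real.continuous_mul_log
    fun_prop
  · intro x hx
    have hx0 : x ≠ 0 := hx.1.ne'
    have h := hasDerivAt_pow (n + 1) x
    refine ((h.div_const (((n : ℝ) + 1) ^ 2)).sub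
      ((h.mul (Real.hasDerivAt_log hx0)).div_const ((n : ℝ) + 1))).congr_deriv ?_
    push_cast
    field_simp
    ring
  · exact fun x hx => mul_nonneg (neg_nonneg.2 (Real.log_nonpos hx.1.le hx.2.le))
      (pow_nonneg hx.1.le n)

theorem J_ENN_rs_eq_tsum_aux_integral (r s k : ℕ) :
    ∫⁻ x : ℝ × ℝ in Set.Ioo (0 : ℝ) 1 ×ˢ Set.Ioo (0 : ℝ) 1,
        ENNReal.ofReal (-Real.log (x.1 * x.2) * x.1 ^ (k + r) * x.2 ^ (k + s)) =
      ENNReal.ofReal (1 / (((k : ℝ) + r + 1) ^ 2 * ((k : ℝ) + s + 1)) +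
        1 / (((k : ℝ) + r + 1) * ((k : ℝ) + s + 1) ^ 2)) := by
  have hsplit : ∀ x ∈ Set.Ioo (0 : ℝ) 1 ×ˢ Set.Ioo (0 : ℝ) 1,
      ENNReal.ofReal (-Real.log (x.1 * x.2) * x.1 ^ (k + r) * x.2 ^ (k + s)) =
        ENNReal.ofReal (-Real.log x.1 * x.1 ^ (k + r)) * ENNReal.ofReal (x.2 ^ (k + s)) +
        ENNReal.ofReal (x.1 ^ (k + r)) * ENNReal.ofReal (-Real.log x.2 * x.2 ^ (k + s)) := by
    rintro ⟨x, y⟩ ⟨⟨hx0, hx1⟩, hy0, hy1⟩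
    dsimp only at *
    have hx : 0 ≤ -Real.log x := neg_nonneg.2 (Real.log_nonpos hx0.le hx1.le)
    have hy : 0 ≤ -Real.log y := neg_nonneg.2 (Real.log_nonpos hy0.le hy1.le)
    rw [← ENNReal.ofReal_mul (by positivity), ← ENNReal.ofReal_mul (by positivity),
      ← ENNReal.ofReal_add (by positivity) (by positivity), Real.log_mul hx0.ne' hy0.ne']
    congr 1
    ring
  rw [setLIntegral_congr_fun (measurableSet_Ioo.prod measurableSet_Ioo) hsplit,
    Measure.volume_eq_prod, ← Measure.prod_restrict, lintegral_add_left (by fun_prop),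
    lintegral_prod_mul (f := fun x => ENNReal.ofReal (-Real.log x * x ^ (k + r)))
      (g := fun y => ENNReal.ofReal (y ^ (k + s))) (by fun_prop) (by fun_prop),
    lintegral_prod_mul (f := fun x => ENNReal.ofReal (x ^ (k + r)))
      (g := fun y => ENNReal.ofReal (-Real.log y * y ^ (k + s))) (by fun_prop) (by fun_prop)]
  simp only [lintegral_Ioo_zero_one_pow, lintegral_Ioo_zero_one_neg_log_mul_pow]
  rw [← ENNReal.ofReal_mul (by positivity), ← ENNReal.ofReal_mul (by positivity),
    ← ENNReal.ofReal_add (by positivity) (by positivity)]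
  push_cast
  simp only [one_div_mul_one_div]
end

section
/- For all natural numbers r, s, the lower Lebesgue integral over (0,1)² of ENNReal.ofReal(−log(xy)/(1−xy) · x^r y^s) equals the sum over k ∈ ℕ of ENNReal.ofReal(1/((k+r+1)² (k+s+1)) + 1/((k+r+1)(k+s+1)²)). -/
open MeasureTheory

theorem lintegral_Ioo_ofReal_of_hasDerivAt_of_nonneg {a b : ℝ} (hab : a ≤ b) {F f : ℝ → ℝ}
    (hcont : ContinuousOn F (Set.Icc a b)) (hderiv : ∀ x ∈ Set.Ioo a b, HasDerivAt F (f x) x)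
    (hnonneg : ∀ x ∈ Set.Ioo a b, 0 ≤ f x) :
    ∫⁻ x in Set.Ioo a b, ENNReal.ofReal (f x) = ENNReal.ofReal (F b - F a) := by
  have hint : IntegrableOn f (Set.Ioc a b) :=
    intervalIntegral.integrableOn_deriv_of_nonneg hcont hderiv hnonneg
  rw [← ofReal_integral_eq_lintegral_ofReal (hint.mono_set Set.Ioo_subset_Ioc_self)
      (ae_restrict_of_forall_mem measurableSet_Ioo hnonneg),
    ← integral_Ioc_eq_integral_Ioo, ← intervalIntegral.integral_of_le hab,
    intervalIntegral.integral_eq_sub_of_hasDerivAt_of_le hab hcont hderiv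
      ((intervalIntegrable_iff_integrableOn_Ioc_of_le hab).2 hint)]

theorem ofReal_neg_log_div_one_sub_eq_tsum (r s : ℕ) {x y : ℝ} (hx : x ∈ Set.Ioo (0 : ℝ) 1)
    (hy : y ∈ Set.Ioo (0 : ℝ) 1) :
    ENNReal.ofReal (-Real.log (x * y) / (1 - x * y) * x ^ r * y ^ s) =
      ∑' k : ℕ, (ENNReal.ofReal (-Real.log x * x ^ (k + r)) * ENNReal.ofReal (y ^ (k + s)) +
        ENNReal.ofReal (x ^ (k + r)) * ENNReal.ofReal (-Real.log y * y ^ (k + s))) := by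
  obtain ⟨hx0, hx1⟩ := hx
  obtain ⟨hy0, hy1⟩ := hy
  have hlx : 0 ≤ -Real.log x := neg_nonneg.2 (Real.log_nonpos hx0.le hx1.le)
  have hly : 0 ≤ -Real.log y := neg_nonneg.2 (Real.log_nonpos hy0.le hy1.le)
  have hterm (k : ℕ) :
      ENNReal.ofReal (-Real.log x * x ^ (k + r)) * ENNReal.ofReal (y ^ (k + s)) +
        ENNReal.ofReal (x ^ (k + r)) * ENNReal.ofReal (-Real.log y * y ^ (k + s)) =
      ENNReal.ofReal ((-Real.log x + -Real.log y) * x ^ r * y ^ s * (x * y) ^ k) := by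
    rw [← ENNReal.ofReal_mul (by positivity), ← ENNReal.ofReal_mul (by positivity),
      ← ENNReal.ofReal_add (by positivity) (by positivity)]
    congr 1
    ring
  have hsum := (hasSum_geometric_of_lt_one (by positivity)
    (mul_lt_one_of_nonneg_of_lt_one_left hx0.le hx1 hy1.le)).mul_left
      ((-Real.log x + -Real.log y) * x ^ r * y ^ s)
  simp_rw [hterm]
  rw [← ENNReal.ofReal_tsum_of_nonneg (fun k ↦ by positivity) hsum.summable, hsum.tsum_eq,
    Real.log_mul hx0.ne' hy0.ne']
  congr 1
  ring

theorem J_ENN_rs_eq_tsum (r s : ℕ) :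
    ∫⁻ x : ℝ × ℝ in Set.Ioo (0 : ℝ) 1 ×ˢ Set.Ioo (0 : ℝ) 1,
        ENNReal.ofReal (-Real.log (x.1 * x.2) / (1 - x.1 * x.2) * x.1 ^ r * x.2 ^ s) =
      ∑' k : ℕ, ENNReal.ofReal (1 / (((k : ℝ) + r + 1) ^ 2 * ((k : ℝ) + s + 1)) +
        1 / (((k : ℝ) + r + 1) * ((k : ℝ) + s + 1) ^ 2)) := by
  rw [setLIntegral_congr_fun (measurableSet_Ioo.prod measurableSet_Ioo)
      (fun p hp ↦ ofReal_neg_log_div_one_sub_eq_tsum r s hp.1 hp.2),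
    lintegral_tsum (fun k ↦ by fun_prop)]
  refine tsum_congr fun k ↦ ?_
  rw [lintegral_add_left (by fun_prop), Measure.volume_eq_prod, ← Measure.prod_restrict,
    lintegral_prod_mul (f := fun x ↦ ENNReal.ofReal (-Real.log x * x ^ (k + r)))
      (g := fun y ↦ ENNReal.ofReal (y ^ (k + s))) (by fun_prop) (by fun_prop),
    lintegral_prod_mul (f := fun x ↦ ENNReal.ofReal (x ^ (k + r)))
      (g := fun y ↦ ENNReal.ofReal (-Real.log y * y ^ (k + s))) (by fun_prop) (by fun_prop)]
  simp only [lintegral_Ioo_zero_one_pow, lintegral_Ioo_zero_one_neg_log_mul_pow]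
  rw [← ENNReal.ofReal_mul (by positivity), ← ENNReal.ofReal_mul (by positivity),
    ← ENNReal.ofReal_add (by positivity) (by positivity)]
  simp only [Nat.cast_add, one_div_mul_one_div]
end

section
/- For all natural numbers r, s, the lower Lebesgue integral over (0,1)² of ENNReal.ofReal(−log(xy)/(1−xy) · x^r y^s) equals the lower Lebesgue integral over (0,1)³ of ENNReal.ofReal(1/(1−(1−xy)z) · x^r y^s) (in the variables (z,x,y)). -/
open MeasureTheory

theorem one_sub_one_sub_mul_pos {p z : ℝ} (hp : 0 < p) (hz : z ∈ Set.Icc (0 : ℝ) 1) :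
    0 < 1 - (1 - p) * z := by
  rcases hz.2.eq_or_lt with rfl | h
  · linarith
  · nlinarith [mul_nonneg hp.le hz.1]

theorem lintegral_one_div_one_sub_one_sub_mul {p : ℝ} (hp : 0 < p) (hp1 : p < 1) :
    ∫⁻ z in Set.Ioo (0 : ℝ) 1, ENNReal.ofReal (1 / (1 - (1 - p) * z)) =
      ENNReal.ofReal (-Real.log p / (1 - p)) := by
  have hne : (1 - p) ≠ 0 := by linarith
  have hcont : ContinuousOn (fun z : ℝ => 1 / (1 - (1 - p) * z)) (Set.uIcc 0 1) := by
    rw [Set.uIcc_of_le zero_le_one]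
    exact continuousOn_const.div (by fun_prop)
      fun z hz => (one_sub_one_sub_mul_pos hp hz).ne'
  have hint := hcont.intervalIntegrable (μ := volume)
  have hderiv : ∀ z ∈ Set.uIcc (0 : ℝ) 1,
      HasDerivAt (fun z : ℝ => -Real.log (1 - (1 - p) * z) / (1 - p))
        (1 / (1 - (1 - p) * z)) z := by
    intro z hz
    rw [Set.uIcc_of_le zero_le_one] at hz
    have hpos := (one_sub_one_sub_mul_pos hp hz).ne'
    refine (((((hasDerivAt_id z).const_mul (1 - p)).const_sub 1).log hpos).neg.div_const
      (1 - p)).congr_deriv ?_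
    simp only [id]
    field_simp
  have hval := intervalIntegral.integral_eq_sub_of_hasDerivAt hderiv hint
  rw [intervalIntegral.integral_of_le zero_le_one, integral_Ioc_eq_integral_Ioo] at hval
  rw [← ofReal_integral_eq_lintegral_ofReal, hval]
  · simp
  · exact ((intervalIntegrable_iff_integrableOn_Ioo_of_le zero_le_one).1 hint)
  · filter_upwards [ae_restrict_mem measurableSet_Ioo] with z hz
    exact (one_div_pos.2 (one_sub_one_sub_mul_pos hp (Set.Ioo_subset_Icc_self hz))).le

theorem JENN_eq_triple (r s : ℕ) :
    ∫⁻ x : ℝ × ℝ in Set.Ioo (0 : ℝ) 1 ×ˢ Set.Ioo (0 : ℝ) 1,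
        ENNReal.ofReal (-Real.log (x.1 * x.2) / (1 - x.1 * x.2) * x.1 ^ r * x.2 ^ s) =
      ∫⁻ x : ℝ × ℝ × ℝ in Set.Ioo (0 : ℝ) 1 ×ˢ Set.Ioo (0 : ℝ) 1 ×ˢ Set.Ioo (0 : ℝ) 1,
        ENNReal.ofReal (1 / (1 - (1 - x.2.1 * x.2.2) * x.1) * x.2.1 ^ r * x.2.2 ^ s) := by
  rw [Measure.volume_eq_prod ℝ (ℝ × ℝ), ← Measure.prod_restrict,
    lintegral_prod_symm' _ (by fun_prop)]
  refine setLIntegral_congr_fun (measurableSet_Ioo.prod measurableSet_Ioo) ?_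
  rintro ⟨x, y⟩ ⟨⟨hx0, hx1⟩, hy0, hy1⟩
  dsimp only at *
  have hweight : 0 ≤ x ^ r * y ^ s := by positivity
  simp only [mul_assoc _ (x ^ r) (y ^ s), ENNReal.ofReal_mul' hweight]
  rw [lintegral_mul_const' _ _ ENNReal.ofReal_ne_top,
    lintegral_one_div_one_sub_one_sub_mul (mul_pos hx0 hy0) (by nlinarith)]
end

section
/- For all real numbers x, y, z with 0 < x < 1, 0 < y < 1, 0 < z < 1, one has x(1−x)·y(1−y)·z(1−z)/(1−(1−xy)z) < 1/24. -/
lemma mul_one_sub_sq_le {x : ℝ} (x1 : x ≤ 1) : x * (1 - x) ^ 2 ≤ 4 / 27 := by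
  have h : 0 ≤ (x - 1 / 3) ^ 2 * (4 / 3 - x) := mul_nonneg (sq_nonneg _) (by linarith)
  linarith [show (x - 1 / 3) ^ 2 * (4 / 3 - x) = 4 / 27 - x * (1 - x) ^ 2 by ring]

theorem bound' (x y z : ℝ) (x0 : 0 < x) (x1 : x < 1) (y0 : 0 < y) (y1 : y < 1)
    (z0 : 0 < z) (z1 : z < 1) :
    x * (1 - x) * (y * (1 - y)) * (z * (1 - z)) / (1 - (1 - x * y) * z) <
      (1 / 24 : ℝ) := by
  have hz : 0 < 1 - z := sub_pos.2 z1
  have hD : 0 < 1 - (1 - x * y) * z := by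
    have : 0 < x * y * z := by positivity
    linarith
  have amgm : 4 * (x * y * (z * (1 - z))) ≤ (1 - (1 - x * y) * z) ^ 2 := by
    linarith [sq_nonneg (1 - z - x * y * z)]
  have hxy : x * (1 - x) ^ 2 * (y * (1 - y) ^ 2) ≤ 4 / 27 * (4 / 27) :=
    mul_le_mul (mul_one_sub_sq_le x1.le) (mul_one_sub_sq_le y1.le) (by positivity) (by norm_num)
  have hzz : z * (1 - z) ≤ 1 / 4 := by linarith [sq_nonneg (z - 1 / 2)]
  have hxyz : x * (1 - x) ^ 2 * (y * (1 - y) ^ 2) * (z * (1 - z)) ≤ 4 / 27 * (4 / 27) * (1 / 4) :=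
    mul_le_mul hxy hzz (by positivity) (by norm_num)
  have hsq : (x * (1 - x) * (y * (1 - y)) * (z * (1 - z))) ^ 2 ≤
      ((1 - (1 - x * y) * z) / 27) ^ 2 := by
    calc (x * (1 - x) * (y * (1 - y)) * (z * (1 - z))) ^ 2
        = x * (1 - x) ^ 2 * (y * (1 - y) ^ 2) * (z * (1 - z)) * (x * y * (z * (1 - z))) := by ring
      _ ≤ 4 / 27 * (4 / 27) * (1 / 4) * (x * y * (z * (1 - z))) :=
        mul_le_mul_of_nonneg_right hxyz (by positivity)
      _ ≤ ((1 - (1 - x * y) * z) / 27) ^ 2 := by linarith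
  rw [div_lt_iff₀ hD]
  linarith [le_of_abs_le (abs_le_of_sq_le_sq hsq (by positivity))]
end
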